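/- arXiv:1007.1578 — 10 statements merged into one kernel-verified Lean document; each statement's English description precedes it below -/
import Mathlib

section
/- (Theorem IIA, first half.) Suppose the 1-forms a, b, the 2-forms ρ∥, ρ⊥, σ and the 3-form H on M satisfy the SUSY equations IIA. Then the 2-form F̂ = (1/k⊥)·ρ⊥ + k∥·a∧b is closed, dF̂ = 0, and the 3-form a∧σ + b∧ρ∥ is closed. (In the paper's language: the solution carries a symplectic half-flat SU(2) structure (α̂ = a + i·k∥·b, ω̂ = (1/k⊥)ρ⊥, Ω̂ = σ − (i/k∥)ρ∥) with d(Re α̂) = 0, since a∧σ + b∧ρ∥ = Re(α̂∧Ω̂).) -/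
/-!
The smooth real-valued differential forms on a smooth manifold `M` constitute a
graded-commutative differential graded algebra over `ℝ`.  Since Mathlib does not
provide the exterior derivative of differential forms on manifolds, we axiomatize
this structure: `Λ` is the algebra of smooth real-valued differential forms on `M`
(with `*` the wedge product), `deg p` is the subspace of `p`-forms, and `d` is the
exterior derivative, satisfying the graded Leibniz rule and graded commutativity.
-/

/-- Theorem IIA, first half: a solution of the SUSY equations IIA carries a
symplectic half-flat SU(2) structure `(α̂ = a + i k∥ b, ω̂ = (1/k⊥) ρ⊥,
Ω̂ = σ - (i/k∥) ρ∥)` with `d (Re α̂) = 0`: the fundamental 2-form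
`F̂ = (1/k⊥) ρ⊥ + k∥ a∧b` is closed, and `Re (α̂ ∧ Ω̂) = a∧σ + b∧ρ∥` is closed. -/
theorem susy_IIA_gives_symplectic_half_flat
    {Λ : Type*} [Ring Λ] [Algebra ℝ Λ]
    (deg : ℕ → Submodule ℝ Λ) (d : Λ →ₗ[ℝ] Λ)
    (hleibniz : ∀ (p : ℕ) (x y : Λ), x ∈ deg p →
      d (x * y) = d x * y + ((-1 : ℝ) ^ p) • (x * d y))
    (hcomm : ∀ (p q : ℕ) (x y : Λ), x ∈ deg p → y ∈ deg q →
      x * y = ((-1 : ℝ) ^ (p * q)) • (y * x))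
    (hddeg : ∀ (p : ℕ) (x : Λ), x ∈ deg p → d x ∈ deg (p + 1))
    (hmuldeg : ∀ (p q : ℕ) (x y : Λ), x ∈ deg p → y ∈ deg q → x * y ∈ deg (p + q))
    (kpar kperp : ℝ)
    (hkpar0 : 0 < kpar) (hkpar1 : kpar < 1)
    (hkperp0 : 0 < kperp) (hkperp1 : kperp < 1)
    (hk : kpar ^ 2 + kperp ^ 2 = 1)
    (a b ρpar ρperp σ H : Λ)
    (ha : a ∈ deg 1) (hb : b ∈ deg 1)
    (hρpar : ρpar ∈ deg 2) (hρperp : ρperp ∈ deg 2) (hσ : σ ∈ deg 2)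
    (hH : H ∈ deg 3)
    -- the SUSY equations IIA
    (eq1 : d a = 0)
    (eq2 : kpar • H = kperp • d σ)
    (eq3 : d ρperp = (kpar * kperp) • (a * d b))
    (eq4 : H * a = (-(kperp / kpar)) • d (b * ρpar)) :
    d ((1 / kperp) • ρperp + kpar • (a * b)) = 0 ∧
      d (a * σ + b * ρpar) = 0 := by
  have hdab : d (a * b) = -(a * d b) := by
    rw [hleibniz 1 a b ha, eq1]
    simp
  have hdσ : d σ = (kpar / kperp) • H := by
    rw [div_eq_inv_mul, mul_smul, eq2, inv_smul_smul₀ hkperp0.ne']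
  have haH : a * H = -(H * a) := by
    rw [hcomm 1 3 a H ha hH]
    norm_num
  have hdaσ : d (a * σ) = (kpar / kperp) • (H * a) := by
    rw [hleibniz 1 a σ ha, eq1, hdσ, mul_smul_comm, haH]
    simp
  constructor
  · rw [map_add, map_smul, map_smul, hdab, eq3, smul_smul, smul_neg, ← sub_eq_add_neg, ← sub_smul]
    have hcoef : 1 / kperp * (kpar * kperp) - kpar = 0 := by
      field_simp
      ring
    rw [hcoef, zero_smul]
  · rw [map_add, hdaσ, eq4, smul_smul]
    have hcoef : kpar / kperp * (-(kperp / kpar)) = -1 := by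
      field_simp
    rw [hcoef, neg_one_smul, neg_add_cancel]
end

section
/- (Theorem IIA, second half.) Suppose the 1-forms a, b and the 2-forms ρ∥, ρ⊥, σ on M satisfy da = 0, d((1/k⊥)·ρ⊥ + k∥·a∧b) = 0 and d(a∧σ + b∧ρ∥) = 0 (i.e., the SU(2) structure (α̂ = a + i·k∥·b, ω̂ = (1/k⊥)ρ⊥, Ω̂ = σ − (i/k∥)ρ∥) is symplectic half-flat with d(Re α̂) = 0). Then, setting H := (k⊥/k∥)·dσ, the data (a, b, ρ∥, ρ⊥, σ, H) satisfy the SUSY equations IIA. -/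
/-!
The smooth real-valued differential forms on a smooth manifold `M` constitute a
graded-commutative differential graded algebra over `ℝ`.  Since Mathlib does not
provide the exterior derivative of differential forms on manifolds, we axiomatize
this structure: `Λ` is the algebra of smooth real-valued differential forms on `M`
(with `*` the wedge product), `deg p` is the subspace of `p`-forms, and `d` is the
exterior derivative, satisfying the graded Leibniz rule and graded commutativity.
-/

/-- Theorem IIA, second half: if the SU(2) structure
`(α̂ = a + i k∥ b, ω̂ = (1/k⊥) ρ⊥, Ω̂ = σ - (i/k∥) ρ∥)` is symplectic half-flat
(i.e. `F̂ = (1/k⊥) ρ⊥ + k∥ a∧b` is closed and `Re(α̂ ∧ Ω̂) = a∧σ + b∧ρ∥` is closed)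
with `d (Re α̂) = d a = 0`, then with `H := (k⊥/k∥) dσ` the data
`(a, b, ρ∥, ρ⊥, σ, H)` satisfy the SUSY equations IIA. -/
theorem symplectic_half_flat_gives_susy_IIA
    {Λ : Type*} [Ring Λ] [Algebra ℝ Λ]
    (deg : ℕ → Submodule ℝ Λ) (d : Λ →ₗ[ℝ] Λ)
    (hleibniz : ∀ (p : ℕ) (x y : Λ), x ∈ deg p →
      d (x * y) = d x * y + ((-1 : ℝ) ^ p) • (x * d y))
    (hcomm : ∀ (p q : ℕ) (x y : Λ), x ∈ deg p → y ∈ deg q →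
      x * y = ((-1 : ℝ) ^ (p * q)) • (y * x))
    (hddeg : ∀ (p : ℕ) (x : Λ), x ∈ deg p → d x ∈ deg (p + 1))
    (hmuldeg : ∀ (p q : ℕ) (x y : Λ), x ∈ deg p → y ∈ deg q → x * y ∈ deg (p + q))
    (kpar kperp : ℝ)
    (hkpar0 : 0 < kpar) (hkpar1 : kpar < 1)
    (hkperp0 : 0 < kperp) (hkperp1 : kperp < 1)
    (hk : kpar ^ 2 + kperp ^ 2 = 1)
    (a b ρpar ρperp σ : Λ)
    (ha : a ∈ deg 1) (hb : b ∈ deg 1)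
    (hρpar : ρpar ∈ deg 2) (hρperp : ρperp ∈ deg 2) (hσ : σ ∈ deg 2)
    (h1 : d a = 0)
    (h2 : d ((1 / kperp) • ρperp + kpar • (a * b)) = 0)
    (h3 : d (a * σ + b * ρpar) = 0) :
    ∀ H : Λ, H = (kperp / kpar) • d σ →
      -- the SUSY equations IIA
      d a = 0 ∧
      kpar • H = kperp • d σ ∧
      d ρperp = (kpar * kperp) • (a * d b) ∧
      H * a = (-(kperp / kpar)) • d (b * ρpar) := by
  rintro H rfl
  have hdmul (y : Λ) : d (a * y) = -(a * d y) := by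
    simpa [h1] using hleibniz 1 a y ha
  have hdσ : d σ * a = -(a * d σ) := by
    simpa [Odd.neg_one_pow (show Odd (3 * 1) by decide)] using
      hcomm 3 1 (d σ) a (hddeg 2 σ hσ) ha
  refine ⟨h1, ?_, ?_, ?_⟩
  · rw [smul_smul, mul_div_cancel₀ _ hkpar0.ne']
  · rw [map_add, map_smul, map_smul, hdmul, smul_neg, add_neg_eq_zero] at h2
    rw [mul_comm, mul_smul, ← h2, smul_smul, mul_one_div_cancel hkperp0.ne', one_smul]
  · rw [map_add, hdmul, neg_add_eq_zero] at h3
    rw [smul_mul_assoc, hdσ, ← h3, smul_neg, neg_smul]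
end

section
/- (Theorem IIB, first half.) Suppose the 1-forms a, b, the 2-forms ρ∥, ρ⊥, σ and the 3-form H on M satisfy the SUSY equations IIB, together with the SU(2)-structure compatibility relation σ∧σ = (1/k⊥²)·ρ∥∧ρ∥. Then: (i) d(a∧ρ⊥ − b∧σ) = 0; (ii) d(b∧ρ⊥ + a∧σ) = 0; (iii) d(F̂∧F̂) = 0 where F̂ = (1/k⊥)·ρ∥ + k∥·a∧b. (In the paper's language: both SU(2) structures (α̂₁ = k∥·a + i·b, ω̂, Ω̂) and (α̂₂ = k∥·b − i·a, ω̂, Ω̂), with ω̂ = (1/k⊥)ρ∥ and Ω̂ = (1/k∥)ρ⊥ + iσ, are half-flat, since Re(α̂₁∧Ω̂) = a∧ρ⊥ − b∧σ and Re(α̂₂∧Ω̂) = b∧ρ⊥ + a∧σ, and d(α̂₁) = 0.) -/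
/-!
The smooth real-valued differential forms on a smooth manifold `M` constitute a
graded-commutative differential graded algebra over `ℝ`.  Since Mathlib does not
provide the exterior derivative of differential forms on manifolds, we axiomatize
this structure: `Λ` is the algebra of smooth real-valued differential forms on `M`
(with `*` the wedge product), `deg p` is the subspace of `p`-forms, and `d` is the
exterior derivative, satisfying the graded Leibniz rule and graded commutativity.
-/

/-- Theorem IIB, first half: a solution of the SUSY equations IIB (together with the
SU(2)-structure compatibility relation `σ∧σ = (1/k⊥²) ρ∥∧ρ∥`) carries two half-flat
SU(2) structures `(α̂₁ = k∥ a + i b, ω̂, Ω̂)` and `(α̂₂ = k∥ b - i a, ω̂, Ω̂)`, with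
`ω̂ = (1/k⊥) ρ∥`, `Ω̂ = (1/k∥) ρ⊥ + i σ` and `d α̂₁ = 0`:
(i) `Re(α̂₁ ∧ Ω̂) = a∧ρ⊥ - b∧σ` is closed; (ii) `Re(α̂₂ ∧ Ω̂) = b∧ρ⊥ + a∧σ` is
closed; (iii) `d (F̂ ∧ F̂) = 0` for `F̂ = (1/k⊥) ρ∥ + k∥ a∧b`. -/
theorem susy_IIB_gives_half_flat
    {Λ : Type*} [Ring Λ] [Algebra ℝ Λ]
    (deg : ℕ → Submodule ℝ Λ) (d : Λ →ₗ[ℝ] Λ)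
    (hleibniz : ∀ (p : ℕ) (x y : Λ), x ∈ deg p →
      d (x * y) = d x * y + ((-1 : ℝ) ^ p) • (x * d y))
    (hcomm : ∀ (p q : ℕ) (x y : Λ), x ∈ deg p → y ∈ deg q →
      x * y = ((-1 : ℝ) ^ (p * q)) • (y * x))
    (hddeg : ∀ (p : ℕ) (x : Λ), x ∈ deg p → d x ∈ deg (p + 1))
    (hmuldeg : ∀ (p q : ℕ) (x y : Λ), x ∈ deg p → y ∈ deg q → x * y ∈ deg (p + q))
    (kpar kperp : ℝ)
    (hkpar0 : 0 < kpar) (hkpar1 : kpar < 1)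
    (hkperp0 : 0 < kperp) (hkperp1 : kperp < 1)
    (hk : kpar ^ 2 + kperp ^ 2 = 1)
    (a b ρpar ρperp σ H : Λ)
    (ha : a ∈ deg 1) (hb : b ∈ deg 1)
    (hρpar : ρpar ∈ deg 2) (hρperp : ρperp ∈ deg 2) (hσ : σ ∈ deg 2)
    (hH : H ∈ deg 3)
    -- the SUSY equations IIB
    (eq1 : d a = 0)
    (eq2 : d b = 0)
    (eq3 : kpar • H = kperp • d σ)
    (eq4 : a * H = (-(kperp / kpar)) • (b * d ρperp))
    (eq5 : b * H = (kperp / kpar) • (a * d ρperp))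
    (eq6 : a * b * d ρpar = -(H * σ))
    -- the SU(2)-structure compatibility relation
    (hcompat : σ * σ = (1 / kperp ^ 2) • (ρpar * ρpar)) :
    d (a * ρperp - b * σ) = 0 ∧
    d (b * ρperp + a * σ) = 0 ∧
    d (((1 / kperp) • ρpar + kpar • (a * b)) *
       ((1 / kperp) • ρpar + kpar • (a * b))) = 0 := by
  have hdσ : d σ = (kpar / kperp) • H := by
    rw [div_eq_inv_mul, mul_smul, eq3, smul_smul, inv_mul_cancel₀ hkperp0.ne', one_smul]
  have hd_one : ∀ x y : Λ, x ∈ deg 1 → d x = 0 → d (x * y) = -(x * d y) := by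
    intro x y hx hdx
    simp [hleibniz 1 x y hx, hdx]
  have hd_two : ∀ x y : Λ, x ∈ deg 2 → d (x * y) = d x * y + x * d y := by
    intro x y hx
    simp [hleibniz 2 x y hx]
  have hscalar : kpar / kperp * (kperp / kpar) = 1 := by
    field_simp
  refine ⟨?_, ?_, ?_⟩
  · rw [map_sub, hd_one a _ ha eq1, hd_one b _ hb eq2, hdσ, mul_smul_comm, eq5, smul_smul,
      hscalar, one_smul, sub_self]
  · rw [map_add, hd_one b _ hb eq2, hd_one a _ ha eq1, hdσ, mul_smul_comm, eq4, smul_smul,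
      mul_neg, hscalar, neg_one_smul, neg_neg, neg_add_cancel]
  · have hab : a * b ∈ deg 2 := hmuldeg 1 1 a b ha hb
    have hdab : d (a * b) = 0 := by
      rw [hd_one a b ha eq1, eq2, mul_zero, neg_zero]
    have hρab : ρpar * (a * b) = a * b * ρpar := by
      rw [hcomm 2 2 _ _ hρpar hab, Even.neg_one_pow (by decide), one_smul]
    have hσH : σ * H = H * σ := by
      rw [hcomm 2 3 _ _ hσ hH, Even.neg_one_pow (by decide), one_smul]
    have hdσσ : d (σ * σ) = (2 * (kpar / kperp)) • (H * σ) := by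
      rw [hd_two σ σ hσ, hdσ, smul_mul_assoc, mul_smul_comm, hσH, two_mul, add_smul]
    have hdabρ : d (a * b * ρpar) = -(H * σ) := by
      rw [hd_two _ _ hab, hdab, zero_mul, zero_add, eq6]
    have hdabab : d (a * b * (a * b)) = 0 := by
      rw [hd_two _ _ hab, hdab, zero_mul, mul_zero, add_zero]
    have hF : ((1 / kperp) • ρpar + kpar • (a * b)) * ((1 / kperp) • ρpar + kpar • (a * b)) =
        σ * σ + (2 * (kpar / kperp)) • (a * b * ρpar) +
          kpar ^ 2 • (a * b * (a * b)) := by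
      rw [hcompat]
      simp only [add_mul, mul_add, smul_mul_assoc, mul_smul_comm, hρab]
      module
    rw [hF, map_add, map_add, map_smul, map_smul, hdσσ, hdabρ, hdabab]
    module
end

section
/- (Theorem IIB, second half.) Suppose the 1-forms a, b and the 2-forms ρ∥, ρ⊥, σ on M satisfy da = 0, db = 0, σ∧σ = (1/k⊥²)·ρ∥∧ρ∥, d(a∧ρ⊥ − b∧σ) = 0, d(b∧ρ⊥ + a∧σ) = 0, and d(F̂∧F̂) = 0 where F̂ = (1/k⊥)·ρ∥ + k∥·a∧b (i.e., the two SU(2) structures (α̂₁ = k∥·a + i·b, ω̂, Ω̂) and (α̂₂ = k∥·b − i·a, ω̂, Ω̂), with ω̂ = (1/k⊥)ρ∥, Ω̂ = (1/k∥)ρ⊥ + iσ, are half-flat and dα̂₁ = 0). Then, setting H := (k⊥/k∥)·dσ, the data (a, b, ρ∥, ρ⊥, σ, H) satisfy the SUSY equations IIB. -/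
/-!
The smooth real-valued differential forms on a smooth manifold `M` constitute a
graded-commutative differential graded algebra over `ℝ`.  Since Mathlib does not
provide the exterior derivative of differential forms on manifolds, we axiomatize
this structure: `Λ` is the algebra of smooth real-valued differential forms on `M`
(with `*` the wedge product), `deg p` is the subspace of `p`-forms, and `d` is the
exterior derivative, satisfying the graded Leibniz rule and graded commutativity.
-/

/-- Theorem IIB, second half: if the two SU(2) structures
`(α̂₁ = k∥ a + i b, ω̂, Ω̂)` and `(α̂₂ = k∥ b - i a, ω̂, Ω̂)`, with
`ω̂ = (1/k⊥) ρ∥` and `Ω̂ = (1/k∥) ρ⊥ + i σ`, are half-flat and `d α̂₁ = 0`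
(i.e. `d a = d b = 0`, `d (a∧ρ⊥ - b∧σ) = 0`, `d (b∧ρ⊥ + a∧σ) = 0` and
`d (F̂ ∧ F̂) = 0` for `F̂ = (1/k⊥) ρ∥ + k∥ a∧b`), then with `H := (k⊥/k∥) dσ`
the data `(a, b, ρ∥, ρ⊥, σ, H)` satisfy the SUSY equations IIB. -/
theorem half_flat_gives_susy_IIB
    {Λ : Type*} [Ring Λ] [Algebra ℝ Λ]
    (deg : ℕ → Submodule ℝ Λ) (d : Λ →ₗ[ℝ] Λ)
    (hleibniz : ∀ (p : ℕ) (x y : Λ), x ∈ deg p →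
      d (x * y) = d x * y + ((-1 : ℝ) ^ p) • (x * d y))
    (hcomm : ∀ (p q : ℕ) (x y : Λ), x ∈ deg p → y ∈ deg q →
      x * y = ((-1 : ℝ) ^ (p * q)) • (y * x))
    (hddeg : ∀ (p : ℕ) (x : Λ), x ∈ deg p → d x ∈ deg (p + 1))
    (hmuldeg : ∀ (p q : ℕ) (x y : Λ), x ∈ deg p → y ∈ deg q → x * y ∈ deg (p + q))
    (kpar kperp : ℝ)
    (hkpar0 : 0 < kpar) (hkpar1 : kpar < 1)
    (hkperp0 : 0 < kperp) (hkperp1 : kperp < 1)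
    (hk : kpar ^ 2 + kperp ^ 2 = 1)
    (a b ρpar ρperp σ : Λ)
    (ha : a ∈ deg 1) (hb : b ∈ deg 1)
    (hρpar : ρpar ∈ deg 2) (hρperp : ρperp ∈ deg 2) (hσ : σ ∈ deg 2)
    (h1 : d a = 0)
    (h2 : d b = 0)
    -- the SU(2)-structure compatibility relation
    (hcompat : σ * σ = (1 / kperp ^ 2) • (ρpar * ρpar))
    (h3 : d (a * ρperp - b * σ) = 0)
    (h4 : d (b * ρperp + a * σ) = 0)
    (h5 : d (((1 / kperp) • ρpar + kpar • (a * b)) *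
             ((1 / kperp) • ρpar + kpar • (a * b))) = 0) :
    ∀ H : Λ, H = (kperp / kpar) • d σ →
      -- the SUSY equations IIB
      d a = 0 ∧
      d b = 0 ∧
      kpar • H = kperp • d σ ∧
      a * H = (-(kperp / kpar)) • (b * d ρperp) ∧
      b * H = (kperp / kpar) • (a * d ρperp) ∧
      a * b * d ρpar = -(H * σ) := by
  rintro H rfl
  have hpar : kpar ≠ 0 := hkpar0.ne'
  have hperp : kperp ≠ 0 := hkperp0.ne'
  have hab : a * b ∈ deg 2 := hmuldeg 1 1 a b ha hb
  have d_closed_mul : ∀ x y : Λ, x ∈ deg 1 → d x = 0 → d (x * y) = -(x * d y) := by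
    intro x y hx hdx
    simp [hleibniz 1 x y hx, hdx]
  have d_ab_mul : d (a * b * ρpar) = a * b * d ρpar := by
    rw [mul_assoc, d_closed_mul a _ ha h1, d_closed_mul b _ hb h2, mul_neg, neg_neg, mul_assoc]
  have b_dσ : b * d σ = a * d ρperp := by
    rw [map_sub, d_closed_mul a _ ha h1, d_closed_mul b _ hb h2] at h3
    rw [← sub_eq_zero, ← h3]
    abel
  have a_dσ : a * d σ = -(b * d ρperp) := by
    rw [map_add, d_closed_mul b _ hb h2, d_closed_mul a _ ha h1] at h4
    rw [← sub_eq_zero, ← neg_eq_zero, ← h4]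
    abel
  have a_sq : a * a = 0 := by
    have h := hcomm 1 1 a a ha ha
    simp only [mul_one, pow_one, neg_smul, one_smul] at h
    have h' : (2 : ℝ) • (a * a) = 0 := by
      rw [two_smul]
      exact eq_neg_iff_add_eq_zero.mp h
    exact (smul_eq_zero_iff_right two_ne_zero).mp h'
  have ab_sq : a * b * (a * b) = 0 := by
    have h := hcomm 1 1 b a hb ha
    simp only [mul_one, pow_one, neg_smul, one_smul] at h
    calc a * b * (a * b) = a * (b * a) * b := by simp only [mul_assoc]
      _ = -(a * a * b * b) := by rw [h]; simp [mul_assoc]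
      _ = 0 := by simp [a_sq]
  have ρpar_ab : ρpar * (a * b) = a * b * ρpar := by
    simpa [(by decide : Even 4).neg_one_pow] using hcomm 2 2 ρpar (a * b) hρpar hab
  have d_σ_sq : d (σ * σ) = (2 : ℝ) • (d σ * σ) := by
    have h : σ * d σ = d σ * σ := by
      simpa [(by decide : Even 6).neg_one_pow] using hcomm 2 3 σ (d σ) hσ (hddeg 2 σ hσ)
    rw [hleibniz 2 σ σ hσ, h, two_smul]
    simp
  have F_sq : ((1 / kperp) • ρpar + kpar • (a * b)) * ((1 / kperp) • ρpar + kpar • (a * b)) =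
      σ * σ + (2 * (kpar / kperp)) • (a * b * ρpar) := by
    simp only [add_mul, mul_add, smul_mul_assoc, mul_smul_comm, ρpar_ab, ab_sq, hcompat]
    module
  have key : (2 : ℝ) • (d σ * σ) + (2 * (kpar / kperp)) • (a * b * d ρpar) = 0 := by
    rw [← d_σ_sq, ← d_ab_mul, ← map_smul, ← map_add, ← F_sq, h5]
  refine ⟨h1, h2, ?_, ?_, ?_, ?_⟩
  · rw [smul_smul, mul_div_cancel₀ _ hpar]
  · rw [mul_smul_comm, a_dσ, smul_neg, neg_smul]
  · rw [mul_smul_comm, b_dσ]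
  · have h : a * b * d ρpar + (kperp / kpar) • (d σ * σ) = (kperp / (2 * kpar)) •
        ((2 : ℝ) • (d σ * σ) + (2 * (kpar / kperp)) • (a * b * d ρpar)) := by
      match_scalars <;> field_simp
    rw [key, smul_zero] at h
    rw [smul_mul_assoc]
    exact eq_neg_of_add_eq_zero_left h
end

section
/- (Proposition: Hermitian balanced structures give a family of half-flat structures.) Let a, b be closed 1-forms and ρ, σ 2-forms on M satisfying d(a∧ρ − b∧σ) = 0, d(a∧σ + b∧ρ) = 0 (i.e., dΨ = 0 for Ψ = (a + ib)∧(ρ + iσ)) and a∧dρ = 0. Then for every λ ∈ (0,1) the 3-form (1/λ)·a∧ρ − λ·b∧σ is closed. (Interpretation: if (J, g, α, ω, Ω) is a Hermitian balanced SU(2) structure with dα = 0 and Re(α)∧d(Re Ω) = 0, then for each λ ∈ (0,1) the SU(2) structure (J_λ, g_λ, β_λ = λ·Im α − (i/λ)·Re α, ω, iΩ) is half-flat: its fundamental 2-form equals the original F, which satisfies d(F∧F) = 0, and (1/λ)·a∧ρ − λ·b∧σ = Re(β_λ∧iΩ) is closed.) -/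
/-!
The smooth real-valued differential forms on a smooth manifold `M` constitute a
graded-commutative differential graded algebra over `ℝ`.  Since Mathlib does not
provide the exterior derivative of differential forms on manifolds, we axiomatize
this structure: `Λ` is the algebra of smooth real-valued differential forms on `M`
(with `*` the wedge product), `deg p` is the subspace of `p`-forms, and `d` is the
exterior derivative, satisfying the graded Leibniz rule and graded commutativity.
-/

/-- Proposition: a Hermitian balanced SU(2) structure gives a family of half-flat
structures.  If `a, b` are closed 1-forms with `d (a∧ρ - b∧σ) = 0`,
`d (a∧σ + b∧ρ) = 0` (i.e. `dΨ = 0` for `Ψ = (a+ib) ∧ (ρ+iσ)`) and `a ∧ dρ = 0`,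
then for every `λ ∈ (0,1)` the 3-form `Re (β_λ ∧ iΩ) = (1/λ) a∧ρ - λ b∧σ`
(for `β_λ = λ b - (i/λ) a`) is closed, i.e. the SU(2) structure
`(J_λ, g_λ, β_λ, ω, iΩ)` is half-flat. -/
theorem balanced_gives_half_flat_family
    {Λ : Type*} [Ring Λ] [Algebra ℝ Λ]
    (deg : ℕ → Submodule ℝ Λ) (d : Λ →ₗ[ℝ] Λ)
    (hleibniz : ∀ (p : ℕ) (x y : Λ), x ∈ deg p →
      d (x * y) = d x * y + ((-1 : ℝ) ^ p) • (x * d y))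
    (hcomm : ∀ (p q : ℕ) (x y : Λ), x ∈ deg p → y ∈ deg q →
      x * y = ((-1 : ℝ) ^ (p * q)) • (y * x))
    (hddeg : ∀ (p : ℕ) (x : Λ), x ∈ deg p → d x ∈ deg (p + 1))
    (hmuldeg : ∀ (p q : ℕ) (x y : Λ), x ∈ deg p → y ∈ deg q → x * y ∈ deg (p + q))
    (a b ρ σ : Λ)
    (ha : a ∈ deg 1) (hb : b ∈ deg 1) (hρ : ρ ∈ deg 2) (hσ : σ ∈ deg 2)
    (hda : d a = 0) (hdb : d b = 0)
    (h1 : d (a * ρ - b * σ) = 0)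
    (h2 : d (a * σ + b * ρ) = 0)
    (h3 : a * d ρ = 0) :
    ∀ l : ℝ, 0 < l → l < 1 → d ((1 / l) • (a * ρ) - l • (b * σ)) = 0 := by
  have haρ : d (a * ρ) = 0 := by
    rw [hleibniz 1 a ρ ha, hda, h3, zero_mul, smul_zero, add_zero]
  have hbσ : d (b * σ) = 0 := by
    rwa [map_sub, haρ, zero_sub, neg_eq_zero] at h1
  intro l _ _
  rw [map_sub, map_smul, map_smul, haρ, hbσ, smul_zero, smul_zero, sub_zero]
end

section
/- (Key step of the Betti-number Proposition.) Suppose the 1-forms a, b, the 2-forms ρ∥, ρ⊥, σ and the 3-form H on M satisfy the SUSY equations IIB. Then the 5-forms a∧σ∧σ and b∧σ∧σ are closed: d(a∧σ∧σ) = 0 and d(b∧σ∧σ) = 0. (These 5-forms are, up to constant factors, the Hodge duals *Re α and *Im α for the SU(2)-structure metric; their closedness shows that the closed 1-forms Re α and Im α are harmonic, which is the key step in the paper's proof that a compact 6-manifold admitting a solution of the SUSY equations IIB has first Betti number at least 2, so that no compact simply connected 6-manifold admits such a solution.) -/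
/-- In a graded-commutative algebra over `ℝ`, elements of degree one square to zero. -/
theorem mul_self_eq_zero_of_mem_deg_one
    {Λ : Type*} [Ring Λ] [Algebra ℝ Λ] (deg : ℕ → Submodule ℝ Λ)
    (hcomm : ∀ (p q : ℕ) (x y : Λ), x ∈ deg p → y ∈ deg q →
      x * y = ((-1 : ℝ) ^ (p * q)) • (y * x))
    {c : Λ} (hc : c ∈ deg 1) : c * c = 0 := by
  have h : c * c = -(c * c) := by simpa using hcomm 1 1 c c hc hc
  have h2 : (2 : ℝ) • (c * c) = 0 := by rw [two_smul]; exact add_eq_zero_iff_eq_neg.mpr h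
  exact (smul_eq_zero_iff_right two_ne_zero).mp h2

/-- For a closed form `c` of degree one and a form `σ` of degree two,
`c ∧ σ ∧ σ` is closed as soon as `c ∧ dσ ∧ σ = 0`. -/
theorem d_mul_sq_eq_zero
    {Λ : Type*} [Ring Λ] [Algebra ℝ Λ] (deg : ℕ → Submodule ℝ Λ) (d : Λ →ₗ[ℝ] Λ)
    (hleibniz : ∀ (p : ℕ) (x y : Λ), x ∈ deg p →
      d (x * y) = d x * y + ((-1 : ℝ) ^ p) • (x * d y))
    (hcomm : ∀ (p q : ℕ) (x y : Λ), x ∈ deg p → y ∈ deg q →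
      x * y = ((-1 : ℝ) ^ (p * q)) • (y * x))
    (hddeg : ∀ (p : ℕ) (x : Λ), x ∈ deg p → d x ∈ deg (p + 1))
    {c σ : Λ} (hc : c ∈ deg 1) (hσ : σ ∈ deg 2) (hdc : d c = 0)
    (h : c * (d σ * σ) = 0) : d (c * (σ * σ)) = 0 := by
  have hswap : σ * d σ = d σ * σ := by
    simpa [show (-1 : ℝ) ^ 6 = 1 by norm_num] using hcomm 2 3 σ (d σ) hσ (hddeg 2 σ hσ)
  have hsq : d (σ * σ) = d σ * σ + d σ * σ := by
    simpa [hswap] using hleibniz 2 σ σ hσ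
  rw [hleibniz 1 c _ hc, hdc, hsq, mul_add, h]
  simp

/-- Key step of the Betti-number Proposition: for a solution of the SUSY equations
IIB, the 5-forms `a∧σ∧σ` and `b∧σ∧σ` (which are, up to constant factors, the Hodge
duals `*Re α` and `*Im α` of the closed 1-forms `a = Re α`, `b = Im α`) are closed. -/
theorem susy_IIB_hodge_duals_closed
    {Λ : Type*} [Ring Λ] [Algebra ℝ Λ]
    (deg : ℕ → Submodule ℝ Λ) (d : Λ →ₗ[ℝ] Λ)
    (hleibniz : ∀ (p : ℕ) (x y : Λ), x ∈ deg p →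
      d (x * y) = d x * y + ((-1 : ℝ) ^ p) • (x * d y))
    (hcomm : ∀ (p q : ℕ) (x y : Λ), x ∈ deg p → y ∈ deg q →
      x * y = ((-1 : ℝ) ^ (p * q)) • (y * x))
    (hddeg : ∀ (p : ℕ) (x : Λ), x ∈ deg p → d x ∈ deg (p + 1))
    (hmuldeg : ∀ (p q : ℕ) (x y : Λ), x ∈ deg p → y ∈ deg q → x * y ∈ deg (p + q))
    (kpar kperp : ℝ)
    (hkpar0 : 0 < kpar) (hkpar1 : kpar < 1)
    (hkperp0 : 0 < kperp) (hkperp1 : kperp < 1)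
    (hk : kpar ^ 2 + kperp ^ 2 = 1)
    (a b ρpar ρperp σ H : Λ)
    (ha : a ∈ deg 1) (hb : b ∈ deg 1)
    (hρpar : ρpar ∈ deg 2) (hρperp : ρperp ∈ deg 2) (hσ : σ ∈ deg 2)
    (hH : H ∈ deg 3)
    -- the SUSY equations IIB
    (eq1 : d a = 0)
    (eq2 : d b = 0)
    (eq3 : kpar • H = kperp • d σ)
    (eq4 : a * H = (-(kperp / kpar)) • (b * d ρperp))
    (eq5 : b * H = (kperp / kpar) • (a * d ρperp))
    (eq6 : a * b * d ρpar = -(H * σ)) :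
    d (a * (σ * σ)) = 0 ∧ d (b * (σ * σ)) = 0 := by
  have hdσ : d σ = (kpar / kperp) • H := by
    rw [div_eq_inv_mul, mul_smul, eq3, inv_smul_smul₀ hkperp0.ne']
  have hHσ : H * σ = -(a * b * d ρpar) := by rw [eq6, neg_neg]
  have haa := mul_self_eq_zero_of_mem_deg_one deg hcomm ha
  have hbb := mul_self_eq_zero_of_mem_deg_one deg hcomm hb
  have hba : b * a = -(a * b) := by simpa using hcomm 1 1 b a hb ha
  have haab : a * (a * b) = 0 := by rw [← mul_assoc, haa, zero_mul]
  have hbab : b * (a * b) = 0 := by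
    rw [← mul_assoc, hba, neg_mul, mul_assoc, hbb, mul_zero, neg_zero]
  constructor
  · apply d_mul_sq_eq_zero deg d hleibniz hcomm hddeg ha hσ eq1
    rw [hdσ, smul_mul_assoc, mul_smul_comm, hHσ, mul_neg, ← mul_assoc, haab]
    simp
  · apply d_mul_sq_eq_zero deg d hleibniz hcomm hddeg hb hσ eq2
    rw [hdσ, smul_mul_assoc, mul_smul_comm, hHσ, mul_neg, ← mul_assoc, hbab]
    simp
end

section
/- (Proposition: solutions from hypo 5-manifolds.) Let β, η be closed 1-forms, ω₁, ω₂ closed 2-forms, and ω₃ a 2-form on M with d(ω₃∧η) = 0. (Such data arise on M = P⁵ × S¹ from a hypo SU(2) structure (η, ω₁, ω₂, ω₃) on a compact 5-manifold P with dη = 0 = dω₂, β being the standard closed 1-form on S¹.) Then for every k∥ ∈ (0,1) and k⊥ = √(1 − k∥²): (a) the data a = β, b = (1/k∥)·η, ρ∥ = −k∥·ω₃, ρ⊥ = k⊥·ω₁, σ = ω₂, H = 0 satisfy the SUSY equations IIA; (b) the data a = (1/k∥)·β, b = η, ρ∥ = k⊥·ω₃, ρ⊥ = k∥·ω₁, σ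 = ω₂, H = 0 satisfy the SUSY equations IIB. -/
/-!
The smooth real-valued differential forms on a smooth manifold `M` constitute a
graded-commutative differential graded algebra over `ℝ`.  Since Mathlib does not
provide the exterior derivative of differential forms on manifolds, we axiomatize
this structure: `Λ` is the algebra of smooth real-valued differential forms on `M`
(with `*` the wedge product), `deg p` is the subspace of `p`-forms, and `d` is the
exterior derivative, satisfying the graded Leibniz rule and graded commutativity.
-/

/-- Proposition: solutions from hypo 5-manifolds.  Given closed 1-forms `β, η`,
closed 2-forms `ω₁, ω₂` and a 2-form `ω₃` with `d (ω₃ ∧ η) = 0` (as arise on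
`M = P⁵ × S¹` from a hypo SU(2) structure `(η, ω₁, ω₂, ω₃)` with `dη = 0 = dω₂`
on a compact 5-manifold `P`), for every `k∥ ∈ (0,1)` and `k⊥ = √(1 - k∥²)`:
(a) `a = β`, `b = (1/k∥) η`, `ρ∥ = -k∥ ω₃`, `ρ⊥ = k⊥ ω₁`, `σ = ω₂`, `H = 0`
satisfy the SUSY equations IIA, and
(b) `a = (1/k∥) β`, `b = η`, `ρ∥ = k⊥ ω₃`, `ρ⊥ = k∥ ω₁`, `σ = ω₂`, `H = 0`
satisfy the SUSY equations IIB. -/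
theorem hypo_gives_susy_solutions
    {Λ : Type*} [Ring Λ] [Algebra ℝ Λ]
    (deg : ℕ → Submodule ℝ Λ) (d : Λ →ₗ[ℝ] Λ)
    (hleibniz : ∀ (p : ℕ) (x y : Λ), x ∈ deg p →
      d (x * y) = d x * y + ((-1 : ℝ) ^ p) • (x * d y))
    (hcomm : ∀ (p q : ℕ) (x y : Λ), x ∈ deg p → y ∈ deg q →
      x * y = ((-1 : ℝ) ^ (p * q)) • (y * x))
    (hddeg : ∀ (p : ℕ) (x : Λ), x ∈ deg p → d x ∈ deg (p + 1))
    (hmuldeg : ∀ (p q : ℕ) (x y : Λ), x ∈ deg p → y ∈ deg q → x * y ∈ deg (p + q))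
    (β η ω₁ ω₂ ω₃ : Λ)
    (hβ : β ∈ deg 1) (hη : η ∈ deg 1)
    (hω₁ : ω₁ ∈ deg 2) (hω₂ : ω₂ ∈ deg 2) (hω₃ : ω₃ ∈ deg 2)
    (hdβ : d β = 0) (hdη : d η = 0) (hdω₁ : d ω₁ = 0) (hdω₂ : d ω₂ = 0)
    (hdω₃η : d (ω₃ * η) = 0)
    (kpar kperp : ℝ)
    (hkpar0 : 0 < kpar) (hkpar1 : kpar < 1)
    (hkperp : kperp = Real.sqrt (1 - kpar ^ 2)) :
    -- (a) the SUSY equations IIA for a = β, b = (1/k∥) η, ρ∥ = -k∥ ω₃,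
    --     ρ⊥ = k⊥ ω₁, σ = ω₂, H = 0:
    (d β = 0 ∧
     kpar • (0 : Λ) = kperp • d ω₂ ∧
     d (kperp • ω₁) = (kpar * kperp) • (β * d ((1 / kpar) • η)) ∧
     (0 : Λ) * β = (-(kperp / kpar)) • d (((1 / kpar) • η) * ((-kpar) • ω₃))) ∧
    -- (b) the SUSY equations IIB for a = (1/k∥) β, b = η, ρ∥ = k⊥ ω₃,
    --     ρ⊥ = k∥ ω₁, σ = ω₂, H = 0:
    (d ((1 / kpar) • β) = 0 ∧
     d η = 0 ∧
     kpar • (0 : Λ) = kperp • d ω₂ ∧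
     ((1 / kpar) • β) * (0 : Λ) = (-(kperp / kpar)) • (η * d (kpar • ω₁)) ∧
     η * (0 : Λ) = (kperp / kpar) • (((1 / kpar) • β) * d (kpar • ω₁)) ∧
     ((1 / kpar) • β) * η * d (kperp • ω₃) = -((0 : Λ) * ω₂)) := by
  have hdω₃_η : d ω₃ * η = 0 := by
    simpa [hdη] using (hleibniz 2 ω₃ η hω₃).symm.trans hdω₃η
  have hη_dω₃ : η * d ω₃ = 0 := by
    rw [hcomm 1 3 η (d ω₃) hη (hddeg 2 ω₃ hω₃), hdω₃_η, smul_zero]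
  have hd_ηω₃ : d (η * ω₃) = 0 := by
    rw [hleibniz 1 η ω₃ hη, hdη, hη_dω₃, zero_mul, smul_zero, add_zero]
  refine ⟨⟨hdβ, ?_, ?_, ?_⟩, ?_, hdη, ?_, ?_, ?_, ?_⟩
  all_goals simp [hdβ, hdη, hdω₁, hdω₂, hd_ηω₃, hη_dω₃, mul_assoc]
end

section
/- (Proposition: non-stability of solutions on h₆.) For every t ≠ 0 and θ ∈ ℝ set F_t^θ = β¹⁴ + cos θ·β²³ + 2t·sin θ·β²⁵ − 2t·sin θ·β³⁶ + 4t²·cos θ·β⁵⁶ and Ψ_t^θ = (β¹ + iβ⁴)∧(β² + i·cos θ·β³ + 2ti·sin θ·β⁵)∧(−sin θ·β³ + 2t·cos θ·β⁵ + 2ti·β⁶). Then: (i) d(Re Ψ_t^θ) = 0; (ii) dF_t^θ = 4t²·cos θ·(β¹²⁶ − β¹³⁵), so F_t^θ∧dF_t^θ = 0 and (F_t^θ, Ψ_t^θ) is half-flat for every θ, while F_t^θ is closed if and only if cos θ = 0; (iii) for every λ ∈ (0,1), the form Φ_λ = (λ·β⁴ − (i/λ)·β¹)∧(β² + i·cos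 θ·β³ + 2ti·sin θ·β⁵)∧(−sin θ·β³ + 2t·cos θ·β⁵ + 2ti·β⁶) has d(Re Φ_λ) = 0 if and only if sin θ = 0. Consequently, for θ ∈ (0, π/2) the half-flat structure (F_t^θ, Ψ_t^θ) solves neither the SUSY equations IIA nor IIB, so solutions of these equations are not stable under small deformations within the class of half-flat structures. -/
noncomputable section

/-- `Λ`, the exterior algebra over `ℝ` on six degree-one generators. -/
abbrev Lam : Type := ExteriorAlgebra ℝ (Fin 6 → ℝ)

/-- The six degree-one generators (indexed from `0`, so `β 0` is the paper's `β¹`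
or `e¹`, …, `β 5` is `β⁶` or `e⁶`). -/
def β (i : Fin 6) : Lam := ExteriorAlgebra.ι ℝ (Pi.single i 1)

/-- The real part of the product `(x₁ + i y₁) ∧ (x₂ + i y₂) ∧ (x₃ + i y₃)` of
complex-coefficient forms in `Λ ⊗ ℂ`, expressed in terms of real forms. -/
def reProd3 (x₁ y₁ x₂ y₂ x₃ y₃ : Lam) : Lam :=
  x₁ * x₂ * x₃ - x₁ * y₂ * y₃ - y₁ * x₂ * y₃ - y₁ * y₂ * x₃

/-- The imaginary part of the product `(x₁ + i y₁) ∧ (x₂ + i y₂) ∧ (x₃ + i y₃)` of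
complex-coefficient forms in `Λ ⊗ ℂ`, expressed in terms of real forms. -/
def imProd3 (x₁ y₁ x₂ y₂ x₃ y₃ : Lam) : Lam :=
  x₁ * x₂ * y₃ + x₁ * y₂ * x₃ + y₁ * x₂ * x₃ - y₁ * y₂ * y₃

/-- The graded Leibniz rule: `d (x ∧ y) = dx ∧ y + (-1)^p x ∧ dy` for `p`-forms `x`. -/
def IsLeibniz (d : Lam →ₗ[ℝ] Lam) : Prop :=
  ∀ (p : ℕ) (x y : Lam), x ∈ ⋀[ℝ]^p (Fin 6 → ℝ) →
    d (x * y) = d x * y + ((-1 : ℝ) ^ p) • (x * d y)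

/-- The generators square to zero. -/
theorem β_mul_self (i : Fin 6) : β i * β i = 0 :=
  ExteriorAlgebra.ι_sq_zero _

theorem β_mul_self_mul (i : Fin 6) (x : Lam) : β i * (β i * x) = 0 := by
  rw [← mul_assoc, β_mul_self, zero_mul]

/-- The generators anticommute. -/
theorem β_mul_comm (i j : Fin 6) : β i * β j = -(β j * β i) :=
  eq_neg_of_add_eq_zero_left (ExteriorAlgebra.ι_add_mul_swap _ _)

/-- Oriented form of anticommutativity, for sorting monomials. -/
theorem β_mul_swap (i j : Fin 6) (_ : j < i) : β i * β j = -(β j * β i) :=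
  β_mul_comm i j

theorem β_mul_swap_mul (i j : Fin 6) (_ : j < i) (x : Lam) :
    β i * (β j * x) = -(β j * (β i * x)) := by
  rw [← mul_assoc, β_mul_comm i j, neg_mul, mul_assoc]

/-- The volume form `β¹²³⁴⁵⁶` does not vanish. -/
theorem β_prod_ne_zero : (List.ofFn β).prod ≠ 0 := by
  intro h
  have hι : ExteriorAlgebra.ιMulti ℝ 6 (fun i : Fin 6 => (Pi.single i 1 : Fin 6 → ℝ)) = 0 := by
    rw [ExteriorAlgebra.ιMulti_apply]
    exact h
  have hdet := congrArg (ExteriorAlgebra.liftAlternating (R := ℝ)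
    (Function.update (fun _ => 0) 6 (Matrix.detRowAlternating (n := Fin 6) (R := ℝ)))) hι
  rw [ExteriorAlgebra.liftAlternating_apply_ιMulti, Function.update_self, LinearMap.map_zero] at hdet
  have hone : (fun i : Fin 6 => (Pi.single i 1 : Fin 6 → ℝ)) = (1 : Matrix (Fin 6) (Fin 6) ℝ) := by
    ext i j
    simp [Matrix.one_apply, Pi.single_apply, eq_comm]
  rw [hone] at hdet
  have hdet_one : Matrix.det (1 : Matrix (Fin 6) (Fin 6) ℝ) = 1 := Matrix.det_one
  rw [Matrix.det, hdet] at hdet_one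
  exact zero_ne_one hdet_one

/-- The form `β⁴ ∧ (β¹²⁶ - β¹³⁵)` does not vanish. -/
theorem β_mul_sub_ne_zero :
    β 3 * (β 0 * β 1 * β 5 - β 0 * β 2 * β 4) ≠ 0 := by
  intro h
  apply β_prod_ne_zero
  have h' := congrArg (fun x => x * (β 2 * β 4)) h
  simp (decide := true) only [mul_assoc, sub_mul, mul_sub, zero_mul, β_mul_swap, β_mul_swap_mul,
    β_mul_self, mul_neg, neg_neg, mul_zero, sub_zero, neg_zero,
    neg_eq_zero] at h'
  simpa [List.ofFn_succ] using h'

/-- The Leibniz rule with a generator as left factor. -/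
theorem IsLeibniz.map_β_mul {d : Lam →ₗ[ℝ] Lam} (hd : IsLeibniz d) (i : Fin 6) (x : Lam) :
    d (β i * x) = d (β i) * x - β i * d x := by
  have hmem : β i ∈ ⋀[ℝ]^1 (Fin 6 → ℝ) := by
    rw [ExteriorAlgebra.exteriorPower, pow_one]
    exact LinearMap.mem_range_self _ _
  simpa [sub_eq_add_neg] using hd 1 (β i) x hmem

/-- Proposition (non-stability of solutions on `h₆`).  For `t ≠ 0` and `θ ∈ ℝ`, let
`F_t^θ = β¹⁴ + cos θ β²³ + 2t sin θ β²⁵ - 2t sin θ β³⁶ + 4t² cos θ β⁵⁶`,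
`Ψ_t^θ = (β¹ + iβ⁴)(β² + i cos θ β³ + 2ti sin θ β⁵)(-sin θ β³ + 2t cos θ β⁵ + 2ti β⁶)`
and, for `λ ∈ (0,1)`,
`Φ_λ = (λ β⁴ - (i/λ) β¹)(β² + i cos θ β³ + 2ti sin θ β⁵)(-sin θ β³ + 2t cos θ β⁵ + 2ti β⁶)`.
Then: (i) `d (Re Ψ_t^θ) = 0`; (ii) `d F_t^θ = 4t² cos θ (β¹²⁶ - β¹³⁵)`, so
`F_t^θ ∧ d F_t^θ = 0` and `(F_t^θ, Ψ_t^θ)` is half-flat for all `θ`, while `F_t^θ`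
is closed iff `cos θ = 0`; (iii) for every `λ ∈ (0,1)`, `d (Re Φ_λ) = 0` iff
`sin θ = 0`.  Consequently, for `θ ∈ (0, π/2)` the half-flat structure
`(F_t^θ, Ψ_t^θ)` solves neither the SUSY equations IIA nor IIB. -/
theorem h6_solutions_not_stable
    (d : Lam →ₗ[ℝ] Lam) (hleib : IsLeibniz d)
    (h1 : d (β 0) = 0) (h2 : d (β 1) = 0) (h3 : d (β 2) = 0) (h4 : d (β 3) = 0)
    (h5 : d (β 4) = β 0 * β 1) (h6 : d (β 5) = β 0 * β 2)
    (t θ : ℝ) (ht : t ≠ 0) :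
    ∀ F ΨRe : Lam, ∀ ΦRe : ℝ → Lam,
      F = β 0 * β 3 + Real.cos θ • (β 1 * β 2) + (2 * t * Real.sin θ) • (β 1 * β 4)
            - (2 * t * Real.sin θ) • (β 2 * β 5)
            + (4 * t ^ 2 * Real.cos θ) • (β 4 * β 5) →
      ΨRe = reProd3 (β 0) (β 3)
              (β 1) (Real.cos θ • β 2 + (2 * t * Real.sin θ) • β 4)
              ((-Real.sin θ) • β 2 + (2 * t * Real.cos θ) • β 4) ((2 * t) • β 5) →
      (∀ l : ℝ, ΦRe l = reProd3 (l • β 3) ((-(1 / l)) • β 0)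
              (β 1) (Real.cos θ • β 2 + (2 * t * Real.sin θ) • β 4)
              ((-Real.sin θ) • β 2 + (2 * t * Real.cos θ) • β 4) ((2 * t) • β 5)) →
      -- (i)
      (d ΨRe = 0) ∧
      -- (ii)
      (d F = (4 * t ^ 2 * Real.cos θ) • (β 0 * β 1 * β 5 - β 0 * β 2 * β 4)) ∧
      (F * d F = 0) ∧
      (d F = 0 ↔ Real.cos θ = 0) ∧
      -- (iii)
      (∀ l : ℝ, 0 < l → l < 1 → (d (ΦRe l) = 0 ↔ Real.sin θ = 0)) ∧
      -- consequently, for θ ∈ (0, π/2) neither IIA nor IIB can be solved: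
      (0 < θ → θ < Real.pi / 2 →
        d F ≠ 0 ∧ ∀ l : ℝ, 0 < l → l < 1 → d (ΦRe l) ≠ 0) := by
  intro F ΨRe ΦRe hF hΨ hΦ
  have hcs := Real.sin_sq_add_cos_sq θ
  have hw : β 0 * β 1 * β 5 - β 0 * β 2 * β 4 ≠ 0 := fun h =>
    β_mul_sub_ne_zero (by rw [h, mul_zero])
  have hdF : d F = (4 * t ^ 2 * Real.cos θ) • (β 0 * β 1 * β 5 - β 0 * β 2 * β 4) := by
    subst hF
    simp (decide := true) only [map_add, map_sub, map_smul, mul_assoc, hleib.map_β_mul,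
      h1, h2, h3, h4, h5, h6, zero_mul, mul_zero, β_mul_swap, β_mul_swap_mul,
      β_mul_self, mul_neg, neg_neg]
    module
  have hdF_iff : d F = 0 ↔ Real.cos θ = 0 := by
    rw [hdF, smul_eq_zero_iff_left hw]
    simp [ht]
  have hdΦ (l : ℝ) : d (ΦRe l) = (-(4 * t ^ 2 * Real.sin θ * l)) •
      (-(β 3 * (β 0 * β 1 * β 5 - β 0 * β 2 * β 4))) := by
    rw [hΦ, reProd3]
    simp (decide := true) only [map_add, map_sub, map_smul, map_neg, mul_assoc, mul_add, add_mul,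
      mul_sub, smul_mul_assoc, mul_smul_comm, hleib.map_β_mul,
      h1, h2, h3, h4, h5, h6, zero_mul, mul_zero, β_mul_swap, β_mul_swap_mul,
      β_mul_self, β_mul_self_mul, mul_neg, neg_mul, neg_neg, neg_zero, smul_zero, map_zero]
    module
  have hdΦ_iff (l : ℝ) (hl : 0 < l) : d (ΦRe l) = 0 ↔ Real.sin θ = 0 := by
    rw [hdΦ, smul_eq_zero_iff_left (neg_ne_zero.mpr β_mul_sub_ne_zero)]
    simp [ht, hl.ne']
  refine ⟨?_, hdF, ?_, hdF_iff, fun l hl _ => hdΦ_iff l hl, fun h0 hpi => ⟨?_, ?_⟩⟩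
  · rw [hΨ, reProd3]
    simp (decide := true) only [map_add, map_sub, map_smul, map_neg, mul_assoc, mul_add, add_mul,
      mul_sub, smul_mul_assoc, mul_smul_comm, hleib.map_β_mul,
      h1, h2, h3, h4, h5, h6, zero_mul, mul_zero, β_mul_swap, β_mul_swap_mul,
      β_mul_self, β_mul_self_mul, mul_neg, neg_mul, neg_neg, neg_zero, smul_zero, map_zero]
    linear_combination (norm := module) hcs • ((2 * t) • (β 0 * (β 1 * (β 2 * β 3))))
  · rw [hdF, hF]
    simp (decide := true) only [mul_assoc, add_mul, mul_sub, sub_mul, smul_mul_assoc,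
      mul_smul_comm, mul_zero, β_mul_swap, β_mul_swap_mul, β_mul_self, β_mul_self_mul,
      mul_neg, neg_neg, neg_zero, smul_zero]
    module
  · rw [Ne, hdF_iff]
    exact (Real.cos_pos_of_mem_Ioo ⟨by linarith, hpi⟩).ne'
  · intro l hl _
    rw [Ne, hdΦ_iff l hl]
    exact (Real.sin_pos_of_pos_of_lt_pi h0 (by linarith)).ne'
end
end

section
/- (A half-flat but non-Hermitian-balanced structure on h₄.) The 2-form F = e¹³ + e²⁴ − e⁵⁶ and the complex 3-form Ψ = (e¹ + i·e³)∧(e² + i·e⁴)∧(e⁶ + i·e⁵) satisfy d(F∧F) = 0 and d(Re Ψ) = 0, so (F, Ψ) is half-flat; but d(Im Ψ) = −e¹²³⁴ ≠ 0, so (F, Ψ) is not Hermitian balanced. -/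
noncomputable section

/-- The six degree-one generators (indexed from `0`, so `e 0` is the paper's `e¹`
or `e¹`, …, `e 5` is `e⁶` or `e⁶`). -/
def e (i : Fin 6) : Lam := ExteriorAlgebra.ι ℝ (Pi.single i 1)

theorem e_mul_self (i : Fin 6) : e i * e i = 0 :=
  ExteriorAlgebra.ι_sq_zero _

theorem e_mul_self_mul (i : Fin 6) (x : Lam) : e i * (e i * x) = 0 := by
  rw [← mul_assoc, e_mul_self, zero_mul]

theorem e_mul_comm {i j : Fin 6} (_ : i < j) : e j * e i = -(e i * e j) :=
  eq_neg_of_add_eq_zero_left (ExteriorAlgebra.ι_add_mul_swap _ _)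

theorem e_mul_left_comm {i j : Fin 6} (h : i < j) (x : Lam) :
    e j * (e i * x) = -(e i * (e j * x)) := by
  rw [← mul_assoc, e_mul_comm h, neg_mul, mul_assoc]

theorem IsLeibniz.map_e_mul {d : Lam →ₗ[ℝ] Lam} (hd : IsLeibniz d) (i : Fin 6) (x : Lam) :
    d (e i * x) = d (e i) * x - e i * d x := by
  have he : e i ∈ ⋀[ℝ]^1 (Fin 6 → ℝ) := by
    rw [ExteriorAlgebra.exteriorPower, pow_one]
    exact LinearMap.mem_range_self _ _
  rw [hd 1 _ _ he, pow_one, neg_one_smul, sub_eq_add_neg]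

theorem e_prod_four_ne_zero : e 0 * e 1 * e 2 * e 3 ≠ 0 := by
  let φ : (Fin 6 → ℝ) [⋀^Fin 4]→ₗ[ℝ] ℝ :=
    (Matrix.detRowAlternating (n := Fin 4) (R := ℝ)).compLinearMap
      (LinearMap.funLeft ℝ ℝ (Fin.castLE (by decide : 4 ≤ 6)))
  let v : Fin 4 → Fin 6 → ℝ := fun k => Pi.single (Fin.castLE (by decide) k) 1
  have hv : ExteriorAlgebra.ιMulti ℝ 4 v = e 0 * e 1 * e 2 * e 3 := by
    simp [ExteriorAlgebra.ιMulti_apply, v, e, mul_assoc]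
    rfl
  have hφ : φ v = 1 := by
    have : (fun k => LinearMap.funLeft ℝ ℝ (Fin.castLE (by decide : 4 ≤ 6)) (v k)) =
        (1 : Matrix (Fin 4) (Fin 4) ℝ) := by
      ext k l
      simp [v, LinearMap.funLeft_apply, Matrix.one_apply, Pi.single_apply, eq_comm]
    change Matrix.det (fun k => LinearMap.funLeft ℝ ℝ (Fin.castLE (by decide : 4 ≤ 6)) (v k)) = 1
    rw [this, Matrix.det_one]
  intro h
  have := ExteriorAlgebra.liftAlternating_apply_ιMulti
    (R := ℝ) (Pi.single 4 φ : ∀ i, (Fin 6 → ℝ) [⋀^Fin i]→ₗ[ℝ] ℝ) v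
  rw [hv, h, map_zero, Pi.single_eq_same, hφ] at this
  exact zero_ne_one this

/-- A half-flat but non-Hermitian-balanced structure on `h₄ = (0,0,0,0,12,14+23)`:
`F = e¹³ + e²⁴ - e⁵⁶` and `Ψ = (e¹ + i e³)(e² + i e⁴)(e⁶ + i e⁵)` satisfy
`d (F ∧ F) = 0` and `d (Re Ψ) = 0`, so `(F, Ψ)` is half-flat; but
`d (Im Ψ) = -e¹²³⁴ ≠ 0`, so `(F, Ψ)` is not Hermitian balanced. -/
theorem h4_half_flat_not_balanced
    (d : Lam →ₗ[ℝ] Lam) (hleib : IsLeibniz d)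
    (h1 : d (e 0) = 0) (h2 : d (e 1) = 0) (h3 : d (e 2) = 0) (h4 : d (e 3) = 0)
    (h5 : d (e 4) = e 0 * e 1) (h6 : d (e 5) = e 0 * e 3 + e 1 * e 2) :
    d ((e 0 * e 2 + e 1 * e 3 - e 4 * e 5) * (e 0 * e 2 + e 1 * e 3 - e 4 * e 5)) = 0 ∧
    d (reProd3 (e 0) (e 2) (e 1) (e 3) (e 5) (e 4)) = 0 ∧
    d (imProd3 (e 0) (e 2) (e 1) (e 3) (e 5) (e 4)) = -(e 0 * e 1 * e 2 * e 3) ∧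
    d (imProd3 (e 0) (e 2) (e 1) (e 3) (e 5) (e 4)) ≠ 0 := by
  have him : d (imProd3 (e 0) (e 2) (e 1) (e 3) (e 5) (e 4)) = -(e 0 * e 1 * e 2 * e 3) := by
    simp [imProd3, mul_assoc, hleib.map_e_mul, h1, h2, h3, h4, h5, h6, mul_add,
      e_mul_self, e_mul_comm, e_mul_left_comm]
  refine ⟨?_, ?_, him, ?_⟩
  · simp [mul_assoc, hleib.map_e_mul, h1, h2, h3, h4, h5, h6, mul_add, add_mul, mul_sub, sub_mul,
      e_mul_self, e_mul_self_mul, e_mul_comm, e_mul_left_comm]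
  · simp [reProd3, mul_assoc, hleib.map_e_mul, h1, h2, h3, h4, h5, h6, mul_add,
      e_mul_self, e_mul_self_mul, e_mul_comm, e_mul_left_comm]
  · rw [him]
    exact neg_ne_zero.mpr e_prod_four_ne_zero
end
end

section
/- (Hermitian balanced structure on the solvable Lie algebra s₁.) The 2-form F = β¹² + β³⁵ − β⁴⁶ and the complex 3-form Ψ = (β¹ + iβ²)∧(β³ + iβ⁵)∧(−β⁴ + iβ⁶) satisfy d(F∧F) = 0 and dΨ = 0 (i.e., d(Re Ψ) = 0 and d(Im Ψ) = 0); hence (F, Ψ) is a Hermitian balanced SU(3) structure on s₁. -/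
noncomputable section

theorem β_mul_β_comm (i j : Fin 6) : β j * β i = -(β i * β j) :=
  eq_neg_of_add_eq_zero_left (ExteriorAlgebra.ι_add_mul_swap _ _)

theorem β_mul_β_mul_comm (i j : Fin 6) (x : Lam) : β j * (β i * x) = -(β i * (β j * x)) := by
  rw [← mul_assoc, β_mul_β_comm, neg_mul, mul_assoc]

theorem β_mem_exteriorPower_one (i : Fin 6) : β i ∈ ⋀[ℝ]^1 (Fin 6 → ℝ) :=
  (pow_one (LinearMap.range (ExteriorAlgebra.ι ℝ))).ge (LinearMap.mem_range_self _ _)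

/-- Hermitian balanced structure on the solvable Lie algebra
`s₁ = (0,0,13,-14,15,-16)`: `F = β¹² + β³⁵ - β⁴⁶` and
`Ψ = (β¹ + iβ²)(β³ + iβ⁵)(-β⁴ + iβ⁶)` satisfy `d (F ∧ F) = 0`, `d (Re Ψ) = 0`
and `d (Im Ψ) = 0`; hence `(F, Ψ)` is a Hermitian balanced SU(3) structure. -/
theorem s1_hermitian_balanced
    (d : Lam →ₗ[ℝ] Lam) (hleib : IsLeibniz d)
    (h1 : d (β 0) = 0) (h2 : d (β 1) = 0)
    (h3 : d (β 2) = β 0 * β 2) (h4 : d (β 3) = -(β 0 * β 3))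
    (h5 : d (β 4) = β 0 * β 4) (h6 : d (β 5) = -(β 0 * β 5)) :
    d ((β 0 * β 1 + β 2 * β 4 - β 3 * β 5) * (β 0 * β 1 + β 2 * β 4 - β 3 * β 5)) = 0 ∧
    d (reProd3 (β 0) (β 1) (β 2) (β 4) (-(β 3)) (β 5)) = 0 ∧
    d (imProd3 (β 0) (β 1) (β 2) (β 4) (-(β 3)) (β 5)) = 0 := by
  have comm {i j : Fin 6} (_ : i < j) : β j * β i = -(β i * β j) := β_mul_β_comm i j
  have comm_mul {i j : Fin 6} (_ : i < j) (x : Lam) :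
      β j * (β i * x) = -(β i * (β j * x)) := β_mul_β_mul_comm i j x
  refine ⟨?_, ?_, ?_⟩ <;>
    simp [reProd3, imProd3, mul_add, add_mul, mul_sub, sub_mul, mul_assoc, hleib.map_β_mul,
      h1, h2, h3, h4, h5, h6, β_mul_self, β_mul_self_mul, comm, comm_mul]
end
end
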